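/- For every weighted graph G = (V,E) with edge weights w : E → ℝ≥0 and every edge e ∈ E, the deletion of e decreases γ by at most two: γ(G∖e) ≥ γ(G) − 2, where G∖e := (V, E∖{e}). -/

import Mathlib

namespace Stabilizer

variable {V : Type*} [Fintype V] [DecidableEq V]

/-- The set of vertices covered by a finite set of edges. -/
def edgeVerts (C : Finset (Sym2 V)) : Set V := {v | ∃ e ∈ C, v ∈ e}

/-- A matching of `G`, given as a finite set of pairwise vertex-disjoint edges. -/
def IsMatching (G : SimpleGraph V) (M : Finset (Sym2 V)) : Prop :=
  (↑M ⊆ G.edgeSet) ∧ ∀ e ∈ M, ∀ f ∈ M, e ≠ f → ∀ v : V, v ∈ e → v ∉ f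

/-- The total weight of a finite set of edges. -/
noncomputable def setWeight (w : Sym2 V → ℝ) (M : Finset (Sym2 V)) : ℝ := ∑ e ∈ M, w e

/-- ν(G): the maximum weight of a matching of `G`. -/
noncomputable def nu (G : SimpleGraph V) (w : Sym2 V → ℝ) : ℝ :=
  sSup {r : ℝ | ∃ M : Finset (Sym2 V), IsMatching G M ∧ r = setWeight w M}

/-- A fractional matching of `G`. -/
def IsFracMatching (G : SimpleGraph V) (x : Sym2 V → ℝ) : Prop :=
  (∀ e, 0 ≤ x e) ∧ (∀ e, e ∉ G.edgeSet → x e = 0) ∧ ∀ v : V, ∑ u : V, x s(v, u) ≤ 1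

/-- The weight of a fractional matching. -/
noncomputable def fracWeight (w x : Sym2 V → ℝ) : ℝ := ∑ e : Sym2 V, w e * x e

/-- ν_f(G): the maximum weight of a fractional matching of `G`. -/
noncomputable def nuf (G : SimpleGraph V) (w : Sym2 V → ℝ) : ℝ :=
  sSup {r : ℝ | ∃ x : Sym2 V → ℝ, IsFracMatching G x ∧ r = fracWeight w x}

/-- A maximum-weight fractional matching of `G`. -/
def IsMaxFracMatching (G : SimpleGraph V) (w x : Sym2 V → ℝ) : Prop :=
  IsFracMatching G x ∧ ∀ y : Sym2 V → ℝ, IsFracMatching G y → fracWeight w y ≤ fracWeight w x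

/-- All entries lie in {0, 1/2, 1}. -/
def IsHalfIntegral (x : Sym2 V → ℝ) : Prop := ∀ e, x e = 0 ∨ x e = 1 / 2 ∨ x e = 1

/-- `C` is the edge set of an odd cycle of `G`. -/
def IsOddCycleEdgeSet (G : SimpleGraph V) (C : Finset (Sym2 V)) : Prop :=
  ∃ (v : V) (c : G.Walk v v), c.IsCycle ∧ Odd c.length ∧ c.edges.toFinset = C

/-- `F` is the family 𝒞(x) of vertex-disjoint odd cycles carrying exactly the
half-valued edges of `x`. -/
def IsCycleFamily (G : SimpleGraph V) (x : Sym2 V → ℝ) (F : Finset (Finset (Sym2 V))) : Prop :=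
  (∀ C ∈ F, IsOddCycleEdgeSet G C) ∧
  (∀ C ∈ F, ∀ D ∈ F, C ≠ D → Disjoint (edgeVerts C) (edgeVerts D)) ∧
  (∀ e : Sym2 V, x e = 1 / 2 ↔ ∃ C ∈ F, e ∈ C)

/-- A basic fractional matching of `G`. -/
def IsBasic (G : SimpleGraph V) (x : Sym2 V → ℝ) : Prop :=
  IsFracMatching G x ∧ IsHalfIntegral x ∧ ∃ F, IsCycleFamily G x F

/-- γ(G): the minimum number of odd cycles in the support of a basic
maximum-weight fractional matching of `G`. -/
noncomputable def gamma (G : SimpleGraph V) (w : Sym2 V → ℝ) : ℕ :=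
  sInf {n : ℕ | ∃ (x : Sym2 V → ℝ) (F : Finset (Finset (Sym2 V))),
    IsMaxFracMatching G w x ∧ IsHalfIntegral x ∧ IsCycleFamily G x F ∧ F.card = n}

/-- `G` is stable: ν(G) = ν_f(G). -/
def IsStable (G : SimpleGraph V) (w : Sym2 V → ℝ) : Prop := nu G w = nuf G w

/-- Deletion of a set of vertices (as the spanning subgraph obtained by
removing all edges incident to `S`; matchings, fractional matchings and covers
of `G∖S` correspond to those of this graph). -/
def deleteVerts (G : SimpleGraph V) (S : Set V) : SimpleGraph V where
  Adj a b := G.Adj a b ∧ a ∉ S ∧ b ∉ S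
  symm := ⟨fun _ _ h => ⟨h.1.symm, h.2.2, h.2.1⟩⟩
  loopless := ⟨fun a h => G.loopless.irrefl a h.1⟩

/-- A fractional w-vertex cover of `G`. -/
def IsFracCover (G : SimpleGraph V) (w : Sym2 V → ℝ) (y : V → ℝ) : Prop :=
  (∀ v, 0 ≤ y v) ∧ ∀ a b : V, G.Adj a b → w s(a, b) ≤ y a + y b

noncomputable def coverValue (y : V → ℝ) : ℝ := ∑ v : V, y v

/-- A minimum fractional w-vertex cover of `G`. -/
def IsMinFracCover (G : SimpleGraph V) (w : Sym2 V → ℝ) (y : V → ℝ) : Prop :=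
  IsFracCover G w y ∧ ∀ z : V → ℝ, IsFracCover G w z → coverValue y ≤ coverValue z

/-- M(x): the 1-valued edges of `x`. -/
noncomputable def oneEdges (x : Sym2 V → ℝ) : Finset (Sym2 V) :=
  Finset.univ.filter fun e => x e = 1

/-- `v` is exposed by the matching `M`. -/
def MExposed (M : Finset (Sym2 V)) (v : V) : Prop := ∀ e ∈ M, v ∉ e

/-- A list of edges alternately in and out of `M`. -/
def AltList (M : Finset (Sym2 V)) (l : List (Sym2 V)) : Prop :=
  l.Chain' fun e f => (e ∈ M ↔ f ∉ M)

variable {G : SimpleGraph V}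

/-- An M-alternating walk. -/
def IsAltWalk (M : Finset (Sym2 V)) {a b : V} (p : G.Walk a b) : Prop := AltList M p.edges

/-- A valid walk: it starts (resp. ends) with an M-exposed vertex or an edge of `M`. -/
def IsValidWalk (M : Finset (Sym2 V)) {a b : V} (p : G.Walk a b) : Prop :=
  (MExposed M a ∨ ∃ e ∈ M, p.edges.head? = some e) ∧
  (MExposed M b ∨ ∃ e ∈ M, p.edges.getLast? = some e)

/-- w(P ∩ M), with multiplicity. -/
noncomputable def wIn (w : Sym2 V → ℝ) (M : Finset (Sym2 V)) (l : List (Sym2 V)) : ℝ :=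
  (l.map fun e => if e ∈ M then w e else 0).sum

/-- w(P ∖ M), with multiplicity. -/
noncomputable def wOut (w : Sym2 V → ℝ) (M : Finset (Sym2 V)) (l : List (Sym2 V)) : ℝ :=
  (l.map fun e => if e ∈ M then 0 else w e).sum

/-- An M-augmenting walk. -/
def IsAugWalk (w : Sym2 V → ℝ) (M : Finset (Sym2 V)) {a b : V} (p : G.Walk a b) : Prop :=
  IsAltWalk M p ∧ IsValidWalk M p ∧ wIn w M p.edges < wOut w M p.edges

/-- An M-augmenting path. -/
def IsAugPath (w : Sym2 V → ℝ) (M : Finset (Sym2 V)) {a b : V} (p : G.Walk a b) : Prop :=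
  p.IsPath ∧ IsAugWalk w M p

/-- An M-alternating cycle (an even cycle alternately in and out of `M`). -/
def IsAltCycle (M : Finset (Sym2 V)) {a : V} (c : G.Walk a a) : Prop :=
  c.IsCycle ∧ Even c.length ∧ AltList M c.edges ∧
  ∀ e f : Sym2 V, c.edges.head? = some e → c.edges.getLast? = some f → (e ∈ M ↔ f ∉ M)

/-- An M-augmenting cycle. -/
def IsAugCycle (w : Sym2 V → ℝ) (M : Finset (Sym2 V)) {a : V} (c : G.Walk a a) : Prop :=
  IsAltCycle M c ∧ wIn w M c.edges < wOut w M c.edges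

/-- An M-blossom with base `a` (traversed starting and ending at its base). -/
def IsBlossom (M : Finset (Sym2 V)) {a : V} (c : G.Walk a a) : Prop :=
  c.IsCycle ∧ Odd c.length ∧ AltList M c.edges ∧
  ∀ e : Sym2 V, c.edges.head? = some e → e ∉ M

/-- An M-flower: an M-blossom `c` with base `a` together with a valid M-alternating
path `p` from the base `a` to the root `r`, starting with an edge of `M`. -/
def IsFlower (M : Finset (Sym2 V)) {a r : V} (c : G.Walk a a) (p : G.Walk a r) : Prop :=
  IsBlossom M c ∧ p.IsPath ∧ AltList M p.edges ∧
  (∃ e ∈ M, p.edges.head? = some e) ∧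
  (MExposed M r ∨ ∃ e ∈ M, p.edges.getLast? = some e)

/-- An M-augmenting flower (with root `r`). -/
def IsAugFlower (w : Sym2 V → ℝ) (M : Finset (Sym2 V)) {a r : V}
    (c : G.Walk a a) (p : G.Walk a r) : Prop :=
  IsFlower M c p ∧
  wIn w M c.edges + 2 * wIn w M p.edges < wOut w M c.edges + 2 * wOut w M p.edges

/-- An M-bi-cycle: two M-blossoms `c`, `d` with bases `a`, `b` joined by an odd
M-alternating path `p` starting and ending with edges of `M`. -/
def IsBicycle (M : Finset (Sym2 V)) {a b : V}
    (c : G.Walk a a) (p : G.Walk a b) (d : G.Walk b b) : Prop :=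
  IsBlossom M c ∧ IsBlossom M d ∧ p.IsPath ∧ Odd p.length ∧ AltList M p.edges ∧
  (∃ e ∈ M, p.edges.head? = some e) ∧ (∃ e ∈ M, p.edges.getLast? = some e)

/-- An M-augmenting bi-cycle. -/
def IsAugBicycle (w : Sym2 V → ℝ) (M : Finset (Sym2 V)) {a b : V}
    (c : G.Walk a a) (p : G.Walk a b) (d : G.Walk b b) : Prop :=
  IsBicycle M c p d ∧
  wIn w M c.edges + 2 * wIn w M p.edges + wIn w M d.edges <
    wOut w M c.edges + 2 * wOut w M p.edges + wOut w M d.edges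

/-- All edges of the walk are tight with respect to the fractional vertex cover `y`. -/
def IsTightWalk (w : Sym2 V → ℝ) (y : V → ℝ) {a b : V} (p : G.Walk a b) : Prop :=
  ∀ d ∈ p.darts, y d.toProd.1 + y d.toProd.2 = w s(d.toProd.1, d.toProd.2)

/-- `x'` is the result of alternate rounding on the odd cycle with edge set `C`
at the vertex `u`: on `C` it is 0/1-valued, both edges of `C` at `u` get value 0,
and its 1-valued edges inside `C` perfectly match the remaining vertices of `C`. -/
def AltRoundedOn (x' : Sym2 V → ℝ) (C : Finset (Sym2 V)) (u : V) : Prop :=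
  (∀ e ∈ C, x' e = 0 ∨ x' e = 1) ∧ (∀ e ∈ C, u ∈ e → x' e = 0) ∧
  ∀ z ∈ edgeVerts C, z ≠ u → ∃! e : Sym2 V, e ∈ C ∧ x' e = 1 ∧ z ∈ e

/-- `C` is the vertex set of an odd cycle of `K`. -/
def IsOddCycleVertexSet (K : SimpleGraph V) (C : Finset V) : Prop :=
  ∃ (v : V) (c : K.Walk v v), c.IsCycle ∧ Odd c.length ∧ c.support.toFinset = C

/-- `Packing K S k`: the vertex set `S` is partitioned into edges and exactly `k` odd cycles
of `K`. -/
inductive Packing (K : SimpleGraph V) : Finset V → ℕ → Prop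
  | empty : Packing K ∅ 0
  | edge {a b : V} {S : Finset V} {k : ℕ} : K.Adj a b → a ∉ S → b ∉ S → Packing K S k →
      Packing K (insert a (insert b S)) k
  | cycle {C S : Finset V} {k : ℕ} : IsOddCycleVertexSet K C → Disjoint C S → Packing K S k →
      Packing K (C ∪ S) (k + 1)

theorem Packing.union {K : SimpleGraph V} {S T : Finset V} {k l : ℕ} (hS : Packing K S k)
    (hT : Packing K T l) (hd : Disjoint S T) : Packing K (S ∪ T) (k + l) := by
  induction hS with
  | empty => simpa using hT
  | edge hab ha hb _ ih =>
    simp only [Finset.disjoint_insert_left] at hd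
    rw [Finset.insert_union, Finset.insert_union]
    exact .edge hab (by simp [ha, hd.1]) (by simp [hb, hd.2.1]) (ih hd.2.2)
  | cycle hC hCS _ ih =>
    rw [Finset.disjoint_union_left] at hd
    rw [Finset.union_assoc, Nat.add_right_comm]
    exact .cycle hC (Finset.disjoint_union_right.2 ⟨hCS, hd.1⟩) (ih hd.2)

/-- A path with an odd number of edges has a perfect matching; one with an even number of edges
has a matching exposing only its start. -/
theorem packing_path {K : SimpleGraph V} {a b : V} (p : K.Walk a b) (hp : p.IsPath) :
    (Odd p.length → Packing K p.support.toFinset 0) ∧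
      (Even p.length → Packing K (p.support.toFinset.erase a) 0) := by
  induction p with
  | nil => simpa using Packing.empty
  | @cons u v w h q ih =>
    rw [SimpleGraph.Walk.cons_isPath_iff] at hp
    obtain ⟨ih1, ih2⟩ := ih hp.1
    have hu : u ∉ q.support.toFinset := by simpa using hp.2
    refine ⟨fun ho => ?_, fun he => ?_⟩
    · have he : Even q.length := by
        rw [SimpleGraph.Walk.length_cons] at ho
        grind
      have := Packing.edge h (by simp [hp.2]) (by simp) (ih2 he)
      rw [Finset.insert_erase (by simp)] at this
      simpa using this
    · have ho : Odd q.length := by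
        rw [SimpleGraph.Walk.length_cons] at he
        grind
      simpa [Finset.erase_insert hu] using ih1 ho

theorem IsOddCycleVertexSet.odd_card {K : SimpleGraph V} {C : Finset V}
    (hC : IsOddCycleVertexSet K C) : Odd C.card := by
  obtain ⟨v, c, hc, ho, rfl⟩ := hC
  have h1 : c.support.toFinset = c.support.tail.toFinset := by
    ext u
    rw [List.mem_toFinset, List.mem_toFinset, SimpleGraph.Walk.mem_support_iff]
    refine ⟨?_, Or.inr⟩
    rintro (rfl | h)
    · exact SimpleGraph.Walk.end_mem_tail_support hc.not_nil
    · exact h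
  rw [h1, List.toFinset_card_of_nodup hc.support_nodup]
  simpa using ho

theorem IsOddCycleVertexSet.packing_erase {K : SimpleGraph V} {C : Finset V}
    (hC : IsOddCycleVertexSet K C) {u : V} (hu : u ∈ C) : Packing K (C.erase u) 0 := by
  obtain ⟨v, c, hc, ho, rfl⟩ := hC
  have hu' : u ∈ c.support := by simpa using hu
  have hs : c.support.toFinset = (c.rotate u hu').support.toFinset := by ext; simp
  rw [hs]
  have hc' : (c.rotate u hu').IsCycle := hc.rotate hu'
  have ho' : Odd (c.rotate u hu').length := by simpa using ho
  generalize c.rotate u hu' = d at hc' ho'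
  cases d with
  | nil => simp at hc'
  | cons h q =>
    rw [SimpleGraph.Walk.cons_isCycle_iff] at hc'
    have := (packing_path q.reverse hc'.1.reverse).2 (by
      rw [SimpleGraph.Walk.length_cons] at ho'
      rw [SimpleGraph.Walk.length_reverse]
      grind)
    simpa using this

theorem Packing.exists_matching {K : SimpleGraph V} {S : Finset V} {k : ℕ} (hS : Packing K S k) :
    ∃ T ⊆ S, Packing K T 0 ∧ (S \ T).card ≤ k := by
  induction hS with
  | empty => exact ⟨∅, by simp, .empty, by simp⟩
  | @edge a b S k hab ha hb _ ih =>
    obtain ⟨T, hT, hp, hc⟩ := ih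
    refine ⟨insert a (insert b T), by gcongr, .edge hab (fun h => ha (hT h))
      (fun h => hb (hT h)) hp, le_trans (Finset.card_le_card ?_) hc⟩
    intro x; simp; tauto
  | @cycle C S k hC hCS _ ih =>
    obtain ⟨T, hT, hp, hc⟩ := ih
    obtain ⟨u, hu⟩ : C.Nonempty := Finset.card_pos.1 hC.odd_card.pos
    refine ⟨C.erase u ∪ T, by gcongr; exact Finset.erase_subset _ _,
      (hC.packing_erase hu).union hp
        ((hCS.mono_left (Finset.erase_subset _ _)).mono_right hT), ?_⟩
    have : (C ∪ S) \ (C.erase u ∪ T) ⊆ insert u (S \ T) := by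
      intro x; simp; tauto
    exact (Finset.card_le_card this).trans ((Finset.card_insert_le _ _).trans (by lia))

/-- The edges and odd cycles of a packing: the edges are encoded by an involution `N`. -/
theorem Packing.exists_perm {K : SimpleGraph V} {S : Finset V} {k : ℕ} (hS : Packing K S k) :
    ∃ (N : Equiv.Perm V) (𝒞 : Finset (Finset V)),
      (∀ u, N (N u) = u) ∧ (∀ u, N u ≠ u → K.Adj u (N u)) ∧
      (∀ C ∈ 𝒞, IsOddCycleVertexSet K C) ∧ (∀ C ∈ 𝒞, ∀ D ∈ 𝒞, C ≠ D → Disjoint C D) ∧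
      (∀ C ∈ 𝒞, ∀ u ∈ C, N u = u) ∧ 𝒞.card = k ∧
      ∀ u, u ∈ S ↔ N u ≠ u ∨ ∃ C ∈ 𝒞, u ∈ C := by
  induction hS with
  | empty => exact ⟨1, ∅, by simp⟩
  | @edge a b S k hab ha hb _ ih =>
    obtain ⟨N, 𝒞, h1, h2, h3, h4, h5, h6, h7⟩ := ih
    have hne := hab.ne
    have hNa : N a = a := by by_contra h; exact ha ((h7 a).2 (.inl h))
    have hNb : N b = b := by by_contra h; exact hb ((h7 b).2 (.inl h))
    have hCa : ∀ C ∈ 𝒞, a ∉ C := fun C hC h => ha ((h7 a).2 (.inr ⟨C, hC, h⟩))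
    have hCb : ∀ C ∈ 𝒞, b ∉ C := fun C hC h => hb ((h7 b).2 (.inr ⟨C, hC, h⟩))
    have va : (N * Equiv.swap a b) a = b := by simp [hNb]
    have vb : (N * Equiv.swap a b) b = a := by simp [hNa]
    have vo : ∀ u, u ≠ a → u ≠ b → (N * Equiv.swap a b) u = N u := fun u ha hb => by
      simp [Equiv.swap_apply_of_ne_of_ne ha hb]
    generalize N * Equiv.swap a b = N' at va vb vo
    have hj := N.injective
    refine ⟨N', 𝒞, fun u => ?_, fun u hu => ?_, h3, h4, fun C hC u hu => ?_, h6, fun u => ?_⟩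
    · by_cases hua : u = a
      · rw [hua, va, vb]
      · by_cases hub : u = b
        · rw [hub, vb, va]
        · rw [vo u hua hub, vo (N u) (fun h => hua (hj (h.trans hNa.symm)))
            (fun h => hub (hj (h.trans hNb.symm))), h1]
    · by_cases hua : u = a
      · subst hua; rw [va]; exact hab
      · by_cases hub : u = b
        · subst hub; rw [vb]; exact hab.symm
        · rw [vo u hua hub] at hu ⊢; exact h2 u hu
    · rw [vo u (fun h => hCa C hC (h ▸ hu)) (fun h => hCb C hC (h ▸ hu))]
      exact h5 C hC u hu
    · by_cases hua : u = a
      · subst hua; simp [va, hne.symm]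
      · by_cases hub : u = b
        · subst hub; simp [vb, hne]
        · simp [hua, hub, h7, vo u hua hub]
  | @cycle C S k hC hCS _ ih =>
    obtain ⟨N, 𝒞, h1, h2, h3, h4, h5, h6, h7⟩ := ih
    have hsub : ∀ D ∈ 𝒞, D ⊆ S := fun D hD u hu => (h7 u).2 (.inr ⟨D, hD, hu⟩)
    obtain ⟨w, hw⟩ : C.Nonempty := Finset.card_pos.1 hC.odd_card.pos
    have hwS := Finset.disjoint_left.1 hCS
    have hC𝒞 : C ∉ 𝒞 := fun h => hwS hw (hsub C h hw)
    refine ⟨N, insert C 𝒞, h1, h2, ?_, ?_, ?_, by simp [hC𝒞, h6], fun u => ?_⟩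
    · simpa using ⟨hC, h3⟩
    · intro D hD E hE hne
      rw [Finset.mem_insert] at hD hE
      rcases hD with rfl | hD <;> rcases hE with rfl | hE
      · exact absurd rfl hne
      · exact hCS.mono_right (hsub E hE)
      · exact (hCS.mono_right (hsub D hD)).symm
      · exact h4 D hD E hE hne
    · intro D hD u hu
      rw [Finset.mem_insert] at hD
      rcases hD with rfl | hD
      · by_contra h; exact hwS hu ((h7 u).2 (.inl h))
      · exact h5 D hD u hu
    · simp only [Finset.mem_union, h7, Finset.mem_insert, exists_eq_or_imp]; tauto

/-- An involution without fixed points on `A` that moves along edges gives a perfect matching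
of `A`. -/
theorem packing_of_involution {K : SimpleGraph V} (M : Equiv.Perm V) (hM : ∀ u, M (M u) = u)
    (A : Finset V) (hA : ∀ u ∈ A, M u ∈ A) (hadj : ∀ u ∈ A, K.Adj u (M u)) :
    Packing K A 0 := by
  induction A using Finset.strongInduction with
  | H A ih =>
    obtain rfl | ⟨a, ha⟩ := A.eq_empty_or_nonempty
    · exact .empty
    · have hne := (hadj a ha).ne
      have hj := M.injective
      have h1 : ((A.erase a).erase (M a)) ⊂ A :=
        Finset.ssubset_of_subset_of_ssubset (Finset.erase_subset _ _) (Finset.erase_ssubset ha)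
      have h2 := ih _ h1 (fun u hu => by
        simp only [Finset.mem_erase] at hu ⊢
        grind) (fun u hu => hadj u (by simp at hu; exact hu.2.2))
      have := Packing.edge (hadj a ha) (by simp) (by simp) h2
      rwa [Finset.insert_erase (by simp [hne.symm, hA a ha]), Finset.insert_erase ha] at this

theorem packing_sdiff {K : SimpleGraph V} (𝒞 : Finset (Finset V)) (O : Finset V)
    (hC : ∀ C ∈ 𝒞, IsOddCycleVertexSet K C) (hd : ∀ C ∈ 𝒞, ∀ D ∈ 𝒞, C ≠ D → Disjoint C D)
    (hO : ∀ C ∈ 𝒞, ∀ a ∈ C, ∀ b ∈ C, a ∈ O → b ∈ O → a = b) :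
    Packing K (𝒞.biUnion id \ O) (𝒞.filter (fun C => Disjoint C O)).card := by
  induction 𝒞 using Finset.induction_on with
  | empty => simpa using Packing.empty
  | insert C 𝒞 hC𝒞 ih =>
    have ih' := ih (fun D hD => hC D (Finset.mem_insert_of_mem hD))
      (fun D hD E hE => hd D (Finset.mem_insert_of_mem hD) E (Finset.mem_insert_of_mem hE))
      (fun D hD => hO D (Finset.mem_insert_of_mem hD))
    have hdis : Disjoint C (𝒞.biUnion id) := by
      rw [Finset.disjoint_biUnion_right]
      intro D hD
      exact hd C (Finset.mem_insert_self _ _) D (Finset.mem_insert_of_mem hD)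
        (fun h => hC𝒞 (h ▸ hD))
    have hCo := hC C (Finset.mem_insert_self _ _)
    rw [Finset.biUnion_insert, id, Finset.union_sdiff_distrib]
    by_cases h : Disjoint C O
    · rw [Finset.filter_insert, if_pos h, Finset.card_insert_of_notMem (by simp [hC𝒞]),
        Finset.sdiff_eq_self_of_disjoint h]
      exact .cycle hCo (hdis.mono_right Finset.sdiff_subset) ih'
    · rw [Finset.filter_insert, if_neg h]
      obtain ⟨u, hu, huO⟩ := Finset.not_disjoint_iff.1 h
      have he : C \ O = C.erase u := by
        ext x
        simp only [Finset.mem_sdiff, Finset.mem_erase]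
        have := hO C (Finset.mem_insert_self _ _) x
        grind
      rw [he]
      have := (hCo.packing_erase hu).union ih'
        ((hdis.mono_left (Finset.erase_subset _ _)).mono_right Finset.sdiff_subset)
      simpa using this

section Dihedral

variable {M N : Equiv.Perm V}

theorem involution_zpow_apply (hM : ∀ u, M (M u) = u) (hN : ∀ u, N (N u) = u) (j : ℤ) (u : V) :
    N (((M * N) ^ j) u) = ((M * N) ^ (-j)) (N u) := by
  have hM' : M⁻¹ = M := by ext u; rw [Equiv.Perm.inv_eq_iff_eq, hM]
  have hN' : N⁻¹ = N := by ext u; rw [Equiv.Perm.inv_eq_iff_eq, hN]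
  have h : N * (M * N) * N⁻¹ = (M * N)⁻¹ := by rw [mul_inv_rev, hM', hN']; ext u; simp [hN]
  have h2 : N * (M * N) ^ j * N⁻¹ = (M * N) ^ (-j) := by
    rw [← conj_zpow, h, inv_zpow, zpow_neg]
  have h3 := congrArg (fun σ : Equiv.Perm V => σ (N u)) h2
  simpa using h3

theorem two_mul_dvd_of_fixed (hM : ∀ u, M (M u) = u) (hN : ∀ u, N (N u) = u) {a : V} (ha : N a = a)
    {j : ℤ} (hb : N (((M * N) ^ j) a) = ((M * N) ^ j) a) :
    (MulAction.period (M * N) a : ℤ) ∣ 2 * j := by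
  rw [involution_zpow_apply hM hN, ha] at hb
  rw [← MulAction.zpow_smul_eq_iff_period_dvd, two_mul, zpow_add, mul_smul]
  simp only [Equiv.Perm.smul_def, ← hb]
  rw [← Equiv.Perm.mul_apply, ← zpow_add, add_neg_cancel, zpow_zero, Equiv.Perm.one_apply]

theorem dvd_of_zpow_eq {σ : Equiv.Perm V} {a : V} {i j : ℤ} :
    (σ ^ i) a = (σ ^ j) a ↔ (MulAction.period σ a : ℤ) ∣ i - j := by
  rw [← MulAction.zpow_smul_eq_iff_period_dvd, sub_eq_neg_add, zpow_add, mul_smul, zpow_neg,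
    inv_smul_eq_iff]
  rfl

/-- An orbit of two involutions contains at most two fixed points of one of them. -/
theorem eq_or_eq_of_sameCycle (hM : ∀ u, M (M u) = u) (hN : ∀ u, N (N u) = u) {a b c : V}
    (ha : N a = a) (hb : N b = b) (hc : N c = c) (hab : (M * N).SameCycle a b)
    (hac : (M * N).SameCycle a c) : a = b ∨ a = c ∨ b = c := by
  obtain ⟨j, rfl⟩ := hab
  obtain ⟨k, rfl⟩ := hac
  obtain ⟨p, hp⟩ := two_mul_dvd_of_fixed hM hN ha hb
  obtain ⟨q, hq⟩ := two_mul_dvd_of_fixed hM hN ha hc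
  have e0 : a = ((M * N) ^ (0 : ℤ)) a := by simp
  rcases Int.even_or_odd' p with ⟨p', rfl | rfl⟩
  · left
    rw [eq_comm]
    nth_rw 2 [e0]
    rw [dvd_of_zpow_eq]
    exact ⟨p', by linarith⟩
  · rcases Int.even_or_odd' q with ⟨q', rfl | rfl⟩
    · right; left
      rw [eq_comm]
      nth_rw 2 [e0]
      rw [dvd_of_zpow_eq]
      exact ⟨q', by linarith⟩
    · right; right
      rw [dvd_of_zpow_eq]
      exact ⟨p' - q', by linarith⟩

/-- If an orbit of two involutions contains fixed points of both, then it contains only one fixed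
point of each of them. -/
theorem eq_of_sameCycle_of_fixed (hM : ∀ u, M (M u) = u) (hN : ∀ u, N (N u) = u) {a b e : V}
    (ha : N a = a) (hb : N b = b) (he : M e = e) (hab : (M * N).SameCycle a b)
    (hae : (M * N).SameCycle a e) : a = b := by
  obtain ⟨j, rfl⟩ := hab
  obtain ⟨k, rfl⟩ := hae
  obtain ⟨p, hp⟩ := two_mul_dvd_of_fixed hM hN ha hb
  have h1 : ((M * N) ^ (-k)) a = ((M * N) ^ (k - 1)) a := by
    have h2 : N (((M * N) ^ k) a) = ((M * N) ^ (-k)) a := by rw [involution_zpow_apply hM hN, ha]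
    rw [← h2, sub_eq_neg_add, zpow_add, Equiv.Perm.mul_apply, zpow_neg, zpow_one,
      Equiv.Perm.eq_inv_iff_eq, Equiv.Perm.mul_apply, hN, he]
  rw [dvd_of_zpow_eq] at h1
  obtain ⟨q, hq⟩ := h1
  rw [eq_comm]
  have e0 : a = ((M * N) ^ (0 : ℤ)) a := by simp
  nth_rw 2 [e0]
  rw [dvd_of_zpow_eq]
  generalize (MulAction.period (M * N) a : ℤ) = n at *
  refine ⟨p * k + q * j, ?_⟩
  linear_combination k * hp + j * hq

theorem exists_isolated_of_odd_card (hM : ∀ u, M (M u) = u) (hN : ∀ u, N (N u) = u) {C : Finset V}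
    (hC : Odd C.card) (hfix : ∀ u ∈ C, N u = u) :
    ∃ v ∈ C, ∀ u ∈ C, (M * N).SameCycle v u → u = v := by
  by_contra! hcon
  choose! g hg1 hg2 hg3 using hcon
  have : ∑ v ∈ C, (1 : ZMod 2) = 0 := by
    refine Finset.sum_involution (fun v _ => g v) ?_ (fun v hv _ => hg3 v hv) hg1 ?_
    · intros; decide
    · intro v hv
      rcases eq_or_eq_of_sameCycle hM hN (hfix _ (hg1 v hv)) (hfix _ hv)
        (hfix _ (hg1 _ (hg1 v hv))) (hg2 v hv).symm (hg2 _ (hg1 v hv)) with h | h | h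
      · exact absurd h (hg3 v hv)
      · exact absurd h.symm (hg3 _ (hg1 v hv))
      · exact h.symm
  rw [Finset.sum_const, nsmul_eq_mul, mul_one, ZMod.natCast_eq_zero_iff_even] at this
  exact (Nat.not_even_iff_odd.2 hC) this

end Dihedral

/-- If `Y` can be covered by a packing and the matching encoded by `M` exposes at most `r` vertices
of `Y`, then `Y` can be covered by a packing with at most `r` odd cycles. -/
theorem exists_packing_le {K : SimpleGraph V} {Y S : Finset V} {k r : ℕ} (hYS : Y ⊆ S)
    (hS : Packing K S k) (M : Equiv.Perm V) (hM : ∀ u, M (M u) = u)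
    (hMK : ∀ u, M u ≠ u → K.Adj u (M u)) (hr : (Y.filter fun u => M u = u).card ≤ r) :
    ∃ S' k', Y ⊆ S' ∧ Packing K S' k' ∧ k' ≤ r := by
  classical
  induction k using Nat.strong_induction_on generalizing S with
  | _ k ih =>
  by_cases hkr : k ≤ r
  · exact ⟨S, k, hYS, hS, hkr⟩
  obtain ⟨N, 𝒞, hN, hNK, hC, hd, hfix, rfl, hmem⟩ := hS.exists_perm
  have key : ∀ C ∈ 𝒞, ∃ v ∈ C, ∀ u ∈ C, (M * N).SameCycle v u → u = v := fun C h =>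
    exists_isolated_of_odd_card hM hN (hC C h).odd_card (hfix C h)
  obtain ⟨C₀, hC₀⟩ : 𝒞.Nonempty := Finset.card_pos.1 (by lia)
  have : Nonempty V := (key C₀ hC₀).nonempty
  choose! b hb1 hb2 using key
  have hbN : ∀ C ∈ 𝒞, N (b C) = b C := fun C h => hfix C h _ (hb1 C h)
  have hgood : ∃ C ∈ 𝒞, ∀ e, (M * N).SameCycle (b C) e → M e = e → e ∉ Y := by
    by_contra! hcon
    choose! f hf1 hf2 hf3 using hcon
    refine hkr (le_trans (Finset.card_le_card_of_injOn f ?_ ?_) hr)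
    · intro C h
      simp [hf2 C h, hf3 C h]
    · intro C h D h' hCD
      have h1 : (M * N).SameCycle (b C) (b D) := (hf1 C h).trans (hCD ▸ (hf1 D h').symm)
      have h2 := eq_of_sameCycle_of_fixed hM hN (hbN C h) (hbN D h') (hf2 C h) h1 (hf1 C h)
      by_contra hne
      exact Finset.disjoint_left.1 (hd C h D h' hne) (hb1 C h) (h2 ▸ hb1 D h')
  obtain ⟨C, hC𝒞, hCY⟩ := hgood
  set O : Finset V := Finset.univ.filter fun u => (M * N).SameCycle (b C) u with hO
  have hOmem : ∀ u, u ∈ O ↔ (M * N).SameCycle (b C) u := by simp [hO]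
  have hON : ∀ u, u ∈ O → N u ∈ O := by
    intro u
    rw [hOmem, hOmem]
    rintro ⟨j, rfl⟩
    exact ⟨-j, by rw [involution_zpow_apply hM hN, hbN C hC𝒞]⟩
  have hOM : ∀ u, u ∈ O → M u ∈ O := by
    intro u hu
    have h1 := hON u hu
    rw [hOmem] at h1 ⊢
    have h2 := (Equiv.Perm.sameCycle_apply_right (f := M * N)).2 h1
    simpa [hN] using h2
  have hON' : ∀ u, N u ∈ O → u ∈ O := fun u hu => by simpa [hN] using hON _ hu
  have hsingle : ∀ D ∈ 𝒞, ∀ x ∈ D, ∀ y ∈ D, x ∈ O → y ∈ O → x = y := by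
    intro D hD x hx y hy hxO hyO
    rw [hOmem] at hxO hyO
    by_cases hDC : D = C
    · subst hDC
      rw [hb2 D hD x hx hxO, hb2 D hD y hy hyO]
    · have hbD : b C ∉ D := fun h =>
        Finset.disjoint_left.1 (hd D hD C hC𝒞 hDC) h (hb1 C hC𝒞)
      rcases eq_or_eq_of_sameCycle hM hN (hbN C hC𝒞) (hfix D hD x hx) (hfix D hD y hy) hxO hyO
        with h | h | h
      · exact absurd (h ▸ hx) hbD
      · exact absurd (h ▸ hy) hbD
      · exact h
  have p1 : Packing K (O.filter fun u => M u ≠ u) 0 := by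
    refine packing_of_involution M hM _ (fun u hu => ?_) (fun u hu => ?_)
    · simp only [Finset.mem_filter] at hu ⊢
      exact ⟨hOM u hu.1, fun h => hu.2 (M.injective h)⟩
    · exact hMK u (Finset.mem_filter.1 hu).2
  have p2 : Packing K (Finset.univ.filter fun u => N u ≠ u ∧ u ∉ O) 0 := by
    refine packing_of_involution N hN _ (fun u hu => ?_) (fun u hu => ?_)
    · simp only [Finset.mem_filter, Finset.mem_univ, true_and] at hu ⊢
      exact ⟨fun h => hu.1 (N.injective h), fun h => hu.2 (hON' u h)⟩
    · exact hNK u (Finset.mem_filter.1 hu).2.1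
  have p3 := packing_sdiff 𝒞 O hC hd hsingle
  have hd12 : Disjoint (O.filter fun u => M u ≠ u)
      (Finset.univ.filter fun u => N u ≠ u ∧ u ∉ O) := by
    rw [Finset.disjoint_left]; intro u; simp; tauto
  have hd123 : Disjoint ((O.filter fun u => M u ≠ u) ∪
      (Finset.univ.filter fun u => N u ≠ u ∧ u ∉ O)) (𝒞.biUnion id \ O) := by
    rw [Finset.disjoint_left]
    intro u hu hu'
    simp only [Finset.mem_sdiff, Finset.mem_biUnion, id] at hu'
    obtain ⟨⟨D, hD, huD⟩, huO⟩ := hu'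
    have := hfix D hD u huD
    simp [huO, this] at hu
  have p := (p1.union p2 hd12).union p3 hd123
  refine ih _ ?_ ?_ p
  · have hlt : (𝒞.filter fun D => Disjoint D O).card < 𝒞.card := by
      refine Finset.card_lt_card (Finset.filter_ssubset.2 ⟨C, hC𝒞, fun h => ?_⟩)
      exact Finset.disjoint_left.1 h (hb1 C hC𝒞) ((hOmem _).2 (Equiv.Perm.SameCycle.refl _ _))
    simpa using hlt
  · intro u hu
    have h1 := (hmem u).1 (hYS hu)
    simp only [Finset.mem_union, Finset.mem_filter, Finset.mem_univ, true_and, Finset.mem_sdiff,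
      Finset.mem_biUnion, id]
    by_cases huO : u ∈ O
    · exact .inl (.inl ⟨huO, fun h => hCY u ((hOmem u).1 huO) h hu⟩)
    · tauto

theorem exists_walk_pow {K : SimpleGraph V} {c : Equiv.Perm V} {a : V}
    (h : ∀ j, K.Adj ((c ^ j) a) ((c ^ (j + 1)) a)) (i : ℕ) :
    ∃ p : K.Walk a ((c ^ i) a), p.support = (List.range (i + 1)).map fun j => (c ^ j) a := by
  induction i with
  | zero => exact ⟨(SimpleGraph.Walk.nil : K.Walk a a), SimpleGraph.Walk.support_nil⟩
  | succ i ih =>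
    obtain ⟨p, hp⟩ := ih
    refine ⟨p.concat (h i), ?_⟩
    rw [SimpleGraph.Walk.support_concat, hp, List.range_succ (n := i + 1)]
    simp

theorem packing_support_of_isCycle {K : SimpleGraph V} {c : Equiv.Perm V} (hc : c.IsCycle)
    (h : ∀ u, c u ≠ u → K.Adj u (c u)) : ∃ k, Packing K c.support k := by
  obtain ⟨a, ha⟩ := hc.nonempty_support
  have ha' := Equiv.Perm.mem_support.1 ha
  have hon : c.IsCycleOn c.support := by
    simpa [Equiv.Perm.coe_support_eq_set_support] using hc.isCycleOn
  have hmem : ∀ j, (c ^ j) a ∈ c.support := fun j => Equiv.Perm.pow_apply_mem_support.2 ha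
  have hstep : ∀ j, K.Adj ((c ^ j) a) ((c ^ (j + 1)) a) := fun j => by
    rw [pow_succ', Equiv.Perm.mul_apply]
    exact h _ (Equiv.Perm.mem_support.1 (hmem j))
  have h2 := hc.two_le_card_support
  obtain ⟨n, hn⟩ : ∃ n, c.support.card = n + 1 := ⟨c.support.card - 1, by lia⟩
  obtain ⟨p, hp⟩ := exists_walk_pow hstep n
  have hlen : p.length = n := by
    have := p.length_support
    rw [hp] at this
    simpa using this.symm
  have hpath : p.IsPath := by
    rw [SimpleGraph.Walk.isPath_def, hp]
    refine List.Nodup.map_on (fun i hi j hj hij => ?_) List.nodup_range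
    rw [hon.pow_apply_eq_pow_apply ha, hn] at hij
    rw [List.mem_range] at hi hj
    exact Nat.ModEq.eq_of_lt_of_lt hij hi hj
  have hsupp : p.support.toFinset = c.support := by
    refine Finset.eq_of_subset_of_card_le (fun u hu => ?_) ?_
    · rw [List.mem_toFinset, hp, List.mem_map] at hu
      obtain ⟨j, -, rfl⟩ := hu
      exact hmem j
    · rw [List.toFinset_card_of_nodup hpath.support_nodup, p.length_support, hlen, hn]
  rcases Nat.even_or_odd n with he | ho
  · refine ⟨1, ?_⟩
    have hadj : K.Adj ((c ^ n) a) a := by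
      have := hstep n
      rwa [← hn, ← hc.orderOf, pow_orderOf_eq_one] at this
    have hcyc : IsOddCycleVertexSet K c.support := by
      refine ⟨_, .cons hadj p, ?_, ?_, ?_⟩
      · rw [SimpleGraph.Walk.cons_isCycle_iff]
        refine ⟨hpath, fun hmem => ?_⟩
        rw [Sym2.eq_swap] at hmem
        have := hpath.length_eq_one_of_mem_edges hmem
        grind
      · rw [SimpleGraph.Walk.length_cons, hlen]
        exact he.add_one
      · rw [SimpleGraph.Walk.support_cons, List.toFinset_cons, hsupp,
          Finset.insert_eq_of_mem (hmem n)]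
    simpa using Packing.cycle hcyc (Finset.disjoint_empty_right _) .empty
  · exact ⟨0, hsupp ▸ (packing_path p hpath).1 (by rwa [hlen])⟩

/-- The support of a permutation moving along edges is partitioned into edges and odd cycles. -/
theorem exists_packing_support {K : SimpleGraph V} (σ : Equiv.Perm V)
    (h : ∀ u, σ u ≠ u → K.Adj u (σ u)) : ∃ k, Packing K σ.support k := by
  induction σ using Equiv.Perm.cycle_induction_on with
  | base_one => exact ⟨0, by simpa using Packing.empty⟩
  | base_cycles c hc => exact packing_support_of_isCycle hc h
  | induction_disjoint c τ hd _ ih1 ih2 =>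
    obtain ⟨k, hk⟩ := ih1 fun u hu => by
      have hτ : τ u = u := (hd u).resolve_left hu
      have := h u (by rwa [Equiv.Perm.mul_apply, hτ])
      rwa [Equiv.Perm.mul_apply, hτ] at this
    obtain ⟨l, hl⟩ := ih2 fun u hu => by
      have hc : c (τ u) = τ u := (hd (τ u)).resolve_right fun h => hu (τ.injective h)
      have := h u (by rwa [Equiv.Perm.mul_apply, hc])
      rwa [Equiv.Perm.mul_apply, hc] at this
    exact ⟨k + l, hd.support_mul ▸ hk.union hl hd.disjoint_support⟩

/-- The total value of `x` on the pairs at `u`. -/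
noncomputable def load (x : Sym2 V → ℝ) (u : V) : ℝ := ∑ v : V, x s(u, v)

/-- The graph of the edges on which `x` is positive. -/
def posGraph (x : Sym2 V → ℝ) : SimpleGraph V := SimpleGraph.fromEdgeSet {e | 0 < x e}

theorem IsFracMatching.posGraph_le {x : Sym2 V → ℝ} (hx : IsFracMatching G x) :
    posGraph x ≤ G := by
  intro u v huv
  by_contra h
  have h1 := huv
  rw [posGraph, SimpleGraph.fromEdgeSet_adj, Set.mem_ofPred_eq, hx.2.1 _ h] at h1
  exact lt_irrefl _ h1.1

theorem IsFracMatching.exists_packing {x : Sym2 V → ℝ} (hx : IsFracMatching G x) :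
    ∃ S k, Packing (posGraph x) S k ∧ ∀ u, load x u = 1 → u ∈ S := by
  have hdiag : ∀ u, x s(u, u) = 0 := fun u => hx.2.1 _ (by simp)
  have hle : ∀ u, load x u ≤ 1 := hx.2.2
  set A : Matrix V V ℝ := fun u v => if u = v then 1 - load x u else x s(u, v) with hA
  have hrow : ∀ u, ∑ v, A u v = 1 := fun u => by
    have h1 : ∀ v, A u v = x s(u, v) + if u = v then 1 - load x u else 0 := fun v => by
      by_cases h : u = v
      · subst h; simp [hA, hdiag]
      · simp [hA, h]
    simp_rw [h1]
    rw [Finset.sum_add_distrib, Finset.sum_ite_eq]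
    simp [load]
  have hsymm : ∀ u v, A u v = A v u := fun u v => by
    by_cases h : u = v
    · subst h; rfl
    · simp [hA, h, Ne.symm h, Sym2.eq_swap]
  have hmem : A ∈ doublyStochastic ℝ V := by
    rw [mem_doublyStochastic_iff_sum]
    refine ⟨fun u v => ?_, hrow, fun v => ?_⟩
    · by_cases h : u = v
      · subst h; simp [hA, hle]
      · simpa [hA, h] using hx.1 _
    · rw [← hrow v]
      exact Finset.sum_congr rfl fun u _ => hsymm u v
  obtain ⟨c, hc0, hc1, hcA⟩ := exists_eq_sum_perm_of_mem_doublyStochastic hmem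
  obtain ⟨σ, -, hσ⟩ : ∃ σ ∈ Finset.univ, 0 < c σ := by
    apply Finset.exists_lt_of_sum_lt
    simp [hc1]
  have hpos : ∀ u, 0 < A u (σ u) := fun u => by
    rw [← hcA, Matrix.sum_apply]
    refine Finset.sum_pos' (fun τ _ => ?_) ⟨σ, Finset.mem_univ _, ?_⟩
    · rw [Matrix.smul_apply, Equiv.Perm.permMatrix, PEquiv.toMatrix_apply]
      exact mul_nonneg (hc0 τ) (by split_ifs <;> simp)
    · simpa [Equiv.Perm.permMatrix, PEquiv.toMatrix_apply] using hσ
  obtain ⟨k, hk⟩ := exists_packing_support (K := posGraph x) σ fun u hu => by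
    have := hpos u
    rw [posGraph, SimpleGraph.fromEdgeSet_adj]
    refine ⟨?_, hu.symm⟩
    simpa [hA, hu.symm] using this
  refine ⟨_, k, hk, fun u hu => ?_⟩
  rw [Equiv.Perm.mem_support]
  intro h
  have := hpos u
  simp [hA, h, hu] at this

theorem IsOddCycleVertexSet.mono {K L : SimpleGraph V} (h : K ≤ L) {C : Finset V}
    (hC : IsOddCycleVertexSet K C) : IsOddCycleVertexSet L C := by
  obtain ⟨v, c, hc, ho, rfl⟩ := hC
  exact ⟨v, c.mapLe h, hc.mapLe h, by simpa using ho, by simp⟩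

theorem Packing.mono {K L : SimpleGraph V} (h : K ≤ L) {S : Finset V} {k : ℕ}
    (hS : Packing K S k) : Packing L S k := by
  induction hS with
  | empty => exact .empty
  | edge hab ha hb _ ih => exact .edge (h hab) ha hb ih
  | cycle hC hCS _ ih => exact .cycle (hC.mono h) hCS ih

theorem IsOddCycleEdgeSet.mono {K L : SimpleGraph V} (h : K ≤ L) {C : Finset (Sym2 V)}
    (hC : IsOddCycleEdgeSet K C) : IsOddCycleEdgeSet L C := by
  obtain ⟨v, c, hc, ho, rfl⟩ := hC
  exact ⟨v, c.mapLe h, hc.mapLe h, by simpa using ho, by simp⟩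

theorem IsCycleFamily.mono {K L : SimpleGraph V} (h : K ≤ L) {x : Sym2 V → ℝ}
    {F : Finset (Finset (Sym2 V))} (hF : IsCycleFamily K x F) : IsCycleFamily L x F :=
  ⟨fun C hC => (hF.1 C hC).mono h, hF.2⟩

theorem IsFracMatching.mono {K L : SimpleGraph V} (h : K ≤ L) {x : Sym2 V → ℝ}
    (hx : IsFracMatching K x) : IsFracMatching L x :=
  ⟨hx.1, fun e he => hx.2.1 e fun h' => he (SimpleGraph.edgeSet_mono h h'), hx.2.2⟩

/-- Each vertex of a cycle lies on exactly two of its edges. -/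
theorem card_filter_mem_edges {K : SimpleGraph V} {v : V} {c : K.Walk v v} (hc : c.IsCycle) (u : V) :
    (Finset.univ.filter fun z => s(u, z) ∈ c.edges).card = if u ∈ c.support then 2 else 0 := by
  split_ifs with hu
  · rw [← hc.ncard_neighborSet_toSubgraph_eq_two hu, ← Set.ncard_coe_finset]
    congr 1
    ext z
    simp [SimpleGraph.Walk.adj_toSubgraph_iff_mem_edges]
  · rw [Finset.card_eq_zero, Finset.filter_eq_empty_iff]
    exact fun z _ h => hu (c.fst_mem_support_of_mem_edges h)

theorem edgeVerts_edges {K : SimpleGraph V} {v : V} {c : K.Walk v v} (hc : c.IsCycle) :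
    edgeVerts c.edges.toFinset = {u | u ∈ c.support} := by
  ext u
  simp only [edgeVerts, List.mem_toFinset, Set.mem_ofPred_eq]
  refine ⟨fun ⟨e, he, hu⟩ => c.mem_support_of_mem_edges he hu, fun hu => ?_⟩
  have := card_filter_mem_edges hc u
  rw [if_pos hu] at this
  obtain ⟨z, hz⟩ := Finset.card_pos.1 (this ▸ two_pos)
  exact ⟨_, (Finset.mem_filter.1 hz).2, by simp⟩

/-- A packing is realised by a half-integral fractional matching saturating exactly the packed
vertices. -/
theorem Packing.exists_isFracMatching {K : SimpleGraph V} {S : Finset V} {k : ℕ}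
    (hS : Packing K S k) : ∃ (z : Sym2 V → ℝ) (F : Finset (Finset (Sym2 V))),
      IsFracMatching K z ∧ IsHalfIntegral z ∧ IsCycleFamily K z F ∧ F.card = k ∧
      (∀ C ∈ F, edgeVerts C ⊆ S) ∧ ∀ u, load z u = if u ∈ S then 1 else 0 := by
  induction hS with
  | empty =>
    refine ⟨0, ∅, ⟨by simp, by simp, by simp⟩, by simp [IsHalfIntegral], ⟨by simp, by simp, by simp⟩,
      by simp, by simp, by simp [load]⟩
  | @edge a b S k hab ha hb _ ih =>
    obtain ⟨z, F, hz, hh, ⟨hF1, hF2, hF3⟩, hk, hFS, hl⟩ := ih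
    have hzero : ∀ u ∉ S, ∀ v, z s(u, v) = 0 := fun u hu v => by
      have h1 := hl u
      rw [if_neg hu, load, Finset.sum_eq_zero_iff_of_nonneg (fun _ _ => hz.1 _)] at h1
      exact h1 v (Finset.mem_univ _)
    have hload : ∀ u, load (fun e => z e + if e = s(a, b) then 1 else 0) u =
        if u ∈ insert a (insert b S) then 1 else 0 := fun u => by
      have h1 : load (fun e => z e + if e = s(a, b) then 1 else 0) u =
          load z u + ∑ v, if s(u, v) = s(a, b) then 1 else 0 := by
        simp [load, Finset.sum_add_distrib]
      have hne := hab.ne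
      rw [h1, hl]
      by_cases hua : u = a
      · subst hua
        have : ∀ v, (s(u, v) = s(u, b)) ↔ v = b := fun v => by simp [hne]
        simp [this, ha]
      · by_cases hub : u = b
        · subst hub
          have : ∀ v, (s(u, v) = s(a, u)) ↔ v = a := fun v => by rw [Sym2.eq_swap (a := a)]; simp [hua]
          simp [this, hb]
        · have : ∀ v, ¬ (s(u, v) = s(a, b)) := fun v => by simp [hua, hub]
          simp [this, hua, hub]
    refine ⟨fun e => z e + if e = s(a, b) then 1 else 0, F, ⟨fun e => ?_, fun e he => ?_,
      fun u => ?_⟩, fun e => ?_, ⟨hF1, hF2, fun e => ?_⟩, hk, fun C hC => ?_, hload⟩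
    · have := hz.1 e
      positivity
    · have : e ≠ s(a, b) := fun h => he (h ▸ hab)
      simp [this, hz.2.1 e he]
    · have := hload u
      rw [load] at this
      rw [this]
      split_ifs <;> simp
    · by_cases h : e = s(a, b)
      · simp [h, hzero a ha]
      · simpa [h] using hh e
    · rw [← hF3]
      by_cases h : e = s(a, b)
      · simp [h, hzero a ha]
      · simp [h]
    · exact (hFS C hC).trans (by simp [Set.subset_def]; tauto)
  | @cycle C S k hC hCS _ ih =>
    obtain ⟨z, F, hz, hh, ⟨hF1, hF2, hF3⟩, hk, hFS, hl⟩ := ih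
    obtain ⟨v, c, hc, ho, rfl⟩ := hC
    have hzero : ∀ u ∉ S, ∀ v, z s(u, v) = 0 := fun u hu v => by
      have h1 := hl u
      rw [if_neg hu, load, Finset.sum_eq_zero_iff_of_nonneg (fun _ _ => hz.1 _)] at h1
      exact h1 v (Finset.mem_univ _)
    have hcS : ∀ u ∈ c.support, u ∉ S := fun u hu =>
      Finset.disjoint_left.1 hCS (List.mem_toFinset.2 hu)
    have hedge : ∀ e ∈ c.edges, z e = 0 := fun e he => by
      induction e with
      | _ p q => exact hzero p (hcS p (c.fst_mem_support_of_mem_edges he)) q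
    have hload : ∀ u, load (fun e => z e + if e ∈ c.edges then 1 / 2 else 0) u =
        if u ∈ c.support.toFinset ∪ S then 1 else 0 := fun u => by
      have h1 : load (fun e => z e + if e ∈ c.edges then 1 / 2 else 0) u =
          load z u + ∑ v, if s(u, v) ∈ c.edges then 1 / 2 else 0 := by
        simp [load, Finset.sum_add_distrib]
      rw [h1, hl, ← Finset.sum_filter, Finset.sum_const, card_filter_mem_edges hc]
      by_cases hu : u ∈ c.support
      · simp [hu, hcS u hu]
      · simp [hu]
    have hd : ∀ D ∈ F, Disjoint (edgeVerts c.edges.toFinset) (edgeVerts D) := fun D hD => by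
      rw [edgeVerts_edges hc, Set.disjoint_left]
      exact fun u hu hu' => hcS u hu (hFS D hD hu')
    have hcF : c.edges.toFinset ∉ F := fun h => by
      have := hd _ h
      rw [disjoint_self, edgeVerts_edges hc] at this
      have h2 : v ∈ {u | u ∈ c.support} := c.start_mem_support
      rw [this] at h2
      exact h2
    refine ⟨fun e => z e + if e ∈ c.edges then 1 / 2 else 0, insert c.edges.toFinset F,
      ⟨fun e => ?_, fun e he => ?_, fun u => ?_⟩, fun e => ?_, ⟨?_, ?_, fun e => ?_⟩,
      by rw [Finset.card_insert_of_notMem hcF, hk], ?_, hload⟩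
    · have := hz.1 e
      positivity
    · have : e ∉ c.edges := fun h => he (c.edges_subset_edgeSet h)
      simp [this, hz.2.1 e he]
    · have := hload u
      rw [load] at this
      rw [this]
      split_ifs <;> simp
    · by_cases h : e ∈ c.edges
      · simp [h, hedge e h]
      · simpa [h] using hh e
    · rw [Finset.forall_mem_insert]
      exact ⟨⟨v, c, hc, ho, rfl⟩, hF1⟩
    · intro D hD E hE hne
      rw [Finset.mem_insert] at hD hE
      rcases hD with rfl | hD <;> rcases hE with rfl | hE
      · exact absurd rfl hne
      · exact hd E hE
      · exact (hd D hD).symm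
      · exact hF2 D hD E hE hne
    · rw [Finset.exists_mem_insert, ← hF3, List.mem_toFinset]
      by_cases h : e ∈ c.edges
      · simp [h, hedge e h]
      · simp [h]
    · rw [Finset.forall_mem_insert, edgeVerts_edges hc]
      refine ⟨fun u hu => ?_, fun D hD => (hFS D hD).trans ?_⟩
      · rw [Set.mem_ofPred_eq] at hu
        simp [hu]
      · simp

theorem add_le_load {x : Sym2 V → ℝ} (hx : ∀ e, 0 ≤ x e) {u : V} {e f : Sym2 V} (he : u ∈ e)
    (hf : u ∈ f) (hef : e ≠ f) : x e + x f ≤ load x u := by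
  obtain ⟨p, rfl⟩ := he
  obtain ⟨q, rfl⟩ := hf
  exact Finset.add_le_sum (f := fun v => x s(u, v)) (fun _ _ => hx _) (Finset.mem_univ p)
    (Finset.mem_univ q) (fun h => hef (h ▸ rfl))

theorem IsFracMatching.packing_of_eq_one {x : Sym2 V → ℝ} (hx : IsFracMatching G x)
    (T : Finset (Sym2 V)) (hT : ∀ e ∈ T, x e = 1) :
    Packing (posGraph x) (Finset.univ.filter fun u => ∃ e ∈ T, u ∈ e) 0 := by
  induction T using Finset.induction_on with
  | empty => simpa using Packing.empty
  | insert e T heT ih =>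
    rw [Finset.forall_mem_insert] at hT
    have ih' := ih hT.2
    have hnot : ∀ u ∈ e, u ∉ Finset.univ.filter fun u => ∃ e ∈ T, u ∈ e := by
      intro u hu hu'
      obtain ⟨f, hf, huf⟩ := (Finset.mem_filter.1 hu').2
      have h1 := add_le_load hx.1 hu huf (fun h => heT (h ▸ hf))
      have h2 : load x u ≤ 1 := hx.2.2 u
      rw [hT.1, hT.2 f hf] at h1
      linarith
    induction e with
    | _ a b =>
      have hab : a ≠ b := fun h => by
        have := hx.2.1 s(a, b) (by simp [h])
        rw [hT.1] at this
        exact one_ne_zero this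
      have hadj : (posGraph x).Adj a b := by
        simp [posGraph, hab, hT.1]
      have := Packing.edge hadj (hnot a (by simp)) (hnot b (by simp)) ih'
      convert this using 1
      ext u
      simp [or_assoc]

theorem IsCycleFamily.exists_packing {x : Sym2 V → ℝ} {F : Finset (Finset (Sym2 V))}
    (hx : IsFracMatching G x) (hh : IsHalfIntegral x) (hF : IsCycleFamily G x F) :
    ∃ S, Packing (posGraph x) S F.card ∧ ∀ u, load x u = 1 → u ∈ S := by
  classical
  obtain ⟨hF1, hF2, hF3⟩ := hF
  set vs : Finset (Sym2 V) → Finset V := fun C => Finset.univ.filter (· ∈ edgeVerts C) with hvs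
  have hmem : ∀ u C, u ∈ vs C ↔ u ∈ edgeVerts C := by simp [hvs]
  have hodd : ∀ C ∈ F, IsOddCycleVertexSet (posGraph x) (vs C) := fun C hC => by
    obtain ⟨v, c, hc, ho, rfl⟩ := hF1 C hC
    have hpos : ∀ e ∈ c.edges, e ∈ (posGraph x).edgeSet := fun e he => by
      have h1 := (hF3 e).2 ⟨_, hC, List.mem_toFinset.2 he⟩
      have h2 := G.not_isDiag_of_mem_edgeSet (c.edges_subset_edgeSet he)
      simp [posGraph, h1, h2]
    refine ⟨v, c.transfer _ hpos, hc.transfer hpos, by simpa using ho, ?_⟩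
    ext u
    rw [hmem, edgeVerts_edges hc]
    simp
  have hdis : ∀ C ∈ F, ∀ D ∈ F, C ≠ D → Disjoint (vs C) (vs D) := fun C hC D hD hne => by
    have := hF2 C hC D hD hne
    rw [Set.disjoint_left] at this
    rw [Finset.disjoint_left]
    exact fun u hu hu' => this ((hmem u C).1 hu) ((hmem u D).1 hu')
  have hinj : Set.InjOn vs F := fun C hC D hD h => by
    by_contra hne
    have h1 := hdis C hC D hD hne
    rw [← h, disjoint_self, Finset.bot_eq_empty] at h1
    have h2 := (hodd C hC).odd_card
    simp [h1] at h2
  have p1 := packing_sdiff (K := posGraph x) (F.image vs) ∅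
    (fun C hC => by
      obtain ⟨D, hD, rfl⟩ := Finset.mem_image.1 hC
      exact hodd D hD)
    (fun C hC C' hC' hne => by
      obtain ⟨D, hD, rfl⟩ := Finset.mem_image.1 hC
      obtain ⟨D', hD', rfl⟩ := Finset.mem_image.1 hC'
      exact hdis D hD D' hD' (fun h => hne (h ▸ rfl)))
    (by simp)
  have p2 := hx.packing_of_eq_one (Finset.univ.filter fun e => x e = 1) (by simp)
  have hp := p1.union p2 (by
    rw [Finset.disjoint_left]
    intro u hu hu'
    simp only [Finset.sdiff_empty, Finset.mem_biUnion, Finset.mem_image, id,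
      exists_exists_and_eq_and, hmem] at hu
    simp only [Finset.mem_filter, Finset.mem_univ, true_and] at hu'
    obtain ⟨C, hC, f, hf, huf⟩ := hu
    obtain ⟨e, he, hue⟩ := hu'
    have h0 := (hF3 f).2 ⟨C, hC, hf⟩
    have h1 := add_le_load hx.1 hue huf (fun h => by rw [h, h0] at he; norm_num at he)
    have h2 : load x u ≤ 1 := hx.2.2 u
    rw [he, h0] at h1
    linarith)
  refine ⟨_, by simpa [Finset.filter_true_of_mem, Finset.card_image_of_injOn hinj] using hp,
    fun u hu => ?_⟩
  obtain ⟨v, -, hv⟩ : ∃ v ∈ Finset.univ, x s(u, v) ≠ 0 := by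
    apply Finset.exists_ne_zero_of_sum_ne_zero
    rw [load] at hu
    rw [hu]
    exact one_ne_zero
  simp only [Finset.mem_union, Finset.mem_biUnion, Finset.mem_image, id,
      exists_exists_and_eq_and, hmem, Finset.mem_filter, Finset.mem_univ, true_and]
  rcases hh s(u, v) with h | h | h
  · exact absurd h hv
  · obtain ⟨C, hC, hC'⟩ := (hF3 _).1 h
    exact .inl ⟨C, hC, _, hC', by simp⟩
  · exact .inr ⟨_, h, by simp⟩

theorem load_add (x y : Sym2 V → ℝ) (u : V) : load (x + y) u = load x u + load y u := by
  simp [load, Finset.sum_add_distrib]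

theorem load_smul (c : ℝ) (x : Sym2 V → ℝ) (u : V) : load (c • x) u = c * load x u := by
  simp [load, Finset.mul_sum]

/-- The weight of `x`, penalised by `t` times the load of the vertex `v`. -/
noncomputable def penalised (w : Sym2 V → ℝ) (t : ℝ) (v : V) : (Sym2 V → ℝ) →ₗ[ℝ] ℝ where
  toFun x := fracWeight w x - t * load x v
  map_add' x y := by
    simp only [load_add, fracWeight, Pi.add_apply, mul_add, Finset.sum_add_distrib]
    ring
  map_smul' c x := by
    have : fracWeight w (c • x) = c * fracWeight w x := by
      simp only [fracWeight, Finset.mul_sum, Pi.smul_apply, smul_eq_mul]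
      exact Finset.sum_congr rfl fun _ _ => by ring
    simp only [load_smul, this, RingHom.id_apply, smul_eq_mul]
    ring

theorem penalised_apply (w : Sym2 V → ℝ) (t : ℝ) (v : V) (x : Sym2 V → ℝ) :
    penalised w t v x = fracWeight w x - t * load x v := rfl

theorem IsFracMatching.le_load {x : Sym2 V → ℝ} (hx : IsFracMatching G x) {u : V} {e : Sym2 V}
    (hu : u ∈ e) : x e ≤ load x u := by
  obtain ⟨p, rfl⟩ := hu
  exact Finset.single_le_sum (f := fun v => x s(u, v)) (fun _ _ => hx.1 _) (Finset.mem_univ p)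

/-- A fractional matching supported by two optimal ones, saturating the vertices saturated by both,
is optimal. -/
theorem IsFracMatching.eq_of_optimal {φ : (Sym2 V → ℝ) →ₗ[ℝ] ℝ} {x₁ x₂ z : Sym2 V → ℝ}
    (h₁ : IsFracMatching G x₁) (h₂ : IsFracMatching G x₂) (hz : IsFracMatching G z)
    (o₁ : ∀ y, IsFracMatching G y → φ y ≤ φ x₁) (o₂ : ∀ y, IsFracMatching G y → φ y ≤ φ x₂)
    (hpos : ∀ e, 0 < z e → 0 < x₁ e ∨ 0 < x₂ e)
    (hsat : ∀ u, load x₁ u = 1 → load x₂ u = 1 → load z u = 1) : φ z = φ x₁ := by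
  have h12 : φ x₂ = φ x₁ := le_antisymm (o₁ _ h₂) (o₂ _ h₁)
  have hl₁ : ∀ u, load x₁ u ≤ 1 := h₁.2.2
  have hl₂ : ∀ u, load x₂ u ≤ 1 := h₂.2.2
  set y : ℝ → Sym2 V → ℝ := fun ε => ((1 + ε) / 2) • (x₁ + x₂) + (-ε) • z with hy
  have hye : ∀ e, ∀ᶠ ε in nhdsWithin (0 : ℝ) (Set.Ioi 0), 0 ≤ y ε e := fun e => by
    rcases (hz.1 e).eq_or_lt with h0 | h0
    · filter_upwards [self_mem_nhdsWithin] with ε hε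
      have := h₁.1 e
      have := h₂.1 e
      have hε' : (0 : ℝ) < ε := hε
      simp only [hy, Pi.add_apply, Pi.smul_apply, ← h0, smul_eq_mul, mul_zero, add_zero]
      positivity
    · have hm : 0 < x₁ e + x₂ e := by
        have := h₁.1 e
        have := h₂.1 e
        rcases hpos e h0 with h | h <;> linarith
      refine Filter.Eventually.filter_mono nhdsWithin_le_nhds ?_
      have hc : Continuous fun ε => y ε e := by
        simp only [hy, Pi.add_apply, Pi.smul_apply, smul_eq_mul]
        fun_prop
      have : 0 < y 0 e := by
        simp only [hy, Pi.add_apply, Pi.smul_apply, smul_eq_mul]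
        linarith
      filter_upwards [hc.continuousAt.eventually (lt_mem_nhds this)] with ε hε using hε.le
  have hyl : ∀ u, ∀ᶠ ε in nhdsWithin (0 : ℝ) (Set.Ioi 0), load (y ε) u ≤ 1 := fun u => by
    have hload : ∀ ε, load (y ε) u = (1 + ε) / 2 * (load x₁ u + load x₂ u) - ε * load z u :=
      fun ε => by simp only [hy, load_add, load_smul]; ring
    simp_rw [hload]
    by_cases hs : load x₁ u = 1 ∧ load x₂ u = 1
    · refine Filter.Eventually.of_forall fun ε => ?_
      rw [hs.1, hs.2, hsat u hs.1 hs.2]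
      linarith
    · have hm : (load x₁ u + load x₂ u) / 2 < 1 := by
        by_contra! h
        exact hs ⟨by linarith [hl₁ u, hl₂ u], by linarith [hl₁ u, hl₂ u]⟩
      refine Filter.Eventually.filter_mono nhdsWithin_le_nhds ?_
      have hc : Continuous fun ε => (1 + ε) / 2 * (load x₁ u + load x₂ u) - ε * load z u := by
        fun_prop
      have : (1 + (0 : ℝ)) / 2 * (load x₁ u + load x₂ u) - 0 * load z u < 1 := by linarith
      filter_upwards [hc.continuousAt.eventually (gt_mem_nhds this)] with ε hε using hε.le
  obtain ⟨ε, hε, hε1, hε2⟩ := ((Filter.eventually_all.2 hye).and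
    (Filter.eventually_all.2 hyl)).and self_mem_nhdsWithin |>.exists.imp
      fun ε h => And.intro h.2 h.1
  have hε0 : (0 : ℝ) < ε := hε
  have hfy : IsFracMatching G (y ε) :=
    ⟨hε1, fun e he => by simp [hy, h₁.2.1 e he, h₂.2.1 e he, hz.2.1 e he], hε2⟩
  have h3 := o₁ _ hfy
  have h4 := o₁ _ hz
  simp only [hy, map_add, map_smul, smul_eq_mul, h12] at h3
  have h5 : ε * φ x₁ ≤ ε * φ z := by linarith
  exact le_antisymm h4 (le_of_mul_le_mul_left h5 hε0)

theorem exists_optimal (G : SimpleGraph V) (φ : (Sym2 V → ℝ) →ₗ[ℝ] ℝ) :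
    ∃ x, IsFracMatching G x ∧ ∀ y, IsFracMatching G y → φ y ≤ φ x := by
  have hclosed : IsClosed {x | IsFracMatching G x} := by
    have h1 : IsClosed {x : Sym2 V → ℝ | ∀ e, 0 ≤ x e} := by
      simp only [Set.ofPred_forall]
      exact isClosed_iInter fun e => isClosed_le (by fun_prop) (by fun_prop)
    have h2 : IsClosed {x : Sym2 V → ℝ | ∀ e, e ∉ G.edgeSet → x e = 0} := by
      simp only [Set.ofPred_forall]
      exact isClosed_iInter fun e => isClosed_iInter fun _ =>
        isClosed_eq (by fun_prop) (by fun_prop)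
    have h3 : IsClosed {x : Sym2 V → ℝ | ∀ v, ∑ u, x s(v, u) ≤ 1} := by
      simp only [Set.ofPred_forall]
      exact isClosed_iInter fun e => isClosed_le (by fun_prop) (by fun_prop)
    exact h1.inter (h2.inter h3)
  have hcompact : IsCompact {x | IsFracMatching G x} := by
    refine (isCompact_univ_pi fun _ => isCompact_Icc (a := (0 : ℝ)) (b := 1)).of_isClosed_subset
      hclosed fun x hx e _ => ⟨hx.1 e, ?_⟩
    induction e with
    | _ a b => exact (hx.le_load (Sym2.mem_mk_left a b)).trans (hx.2.2 a)
  obtain ⟨x, hx, hmax⟩ := hcompact.exists_isMaxOn ⟨0, by simp [IsFracMatching]⟩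
    φ.continuous_of_finiteDimensional.continuousOn
  exact ⟨x, hx, fun y hy => hmax hy⟩

/-- A packing supported by two optimal fractional matchings and covering the vertices saturated
by both is realised by an optimal basic fractional matching. -/
theorem Packing.exists_optimal {φ : (Sym2 V → ℝ) →ₗ[ℝ] ℝ} {x₁ x₂ : Sym2 V → ℝ}
    (h₁ : IsFracMatching G x₁) (h₂ : IsFracMatching G x₂)
    (o₁ : ∀ y, IsFracMatching G y → φ y ≤ φ x₁) (o₂ : ∀ y, IsFracMatching G y → φ y ≤ φ x₂)
    {K : SimpleGraph V} (hK : K ≤ posGraph x₁ ⊔ posGraph x₂) {S : Finset V} {k : ℕ}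
    (hS : Packing K S k) (hsat : ∀ u, load x₁ u = 1 → load x₂ u = 1 → u ∈ S) :
    ∃ (z : Sym2 V → ℝ) (F : Finset (Finset (Sym2 V))),
      IsFracMatching K z ∧ IsHalfIntegral z ∧ IsCycleFamily K z F ∧ F.card = k ∧
      (∀ u, load z u = if u ∈ S then 1 else 0) ∧ φ z = φ x₁ := by
  obtain ⟨z, F, hz, hh, hF, hk, -, hl⟩ := hS.exists_isFracMatching
  refine ⟨z, F, hz, hh, hF, hk, hl, h₁.eq_of_optimal h₂
    (hz.mono (hK.trans (sup_le h₁.posGraph_le h₂.posGraph_le))) o₁ o₂ (fun e he => ?_)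
    fun u hu hu' => by rw [hl, if_pos (hsat u hu hu')]⟩
  have heK : e ∈ K.edgeSet := by
    by_contra h
    exact he.ne' (hz.2.1 e h)
  induction e with
  | _ a b =>
    have := hK heK
    rw [SimpleGraph.sup_adj, posGraph, posGraph, SimpleGraph.fromEdgeSet_adj,
      SimpleGraph.fromEdgeSet_adj] at this
    exact this.imp And.left And.left

theorem exists_basic_optimal (G : SimpleGraph V) (φ : (Sym2 V → ℝ) →ₗ[ℝ] ℝ) :
    ∃ (x : Sym2 V → ℝ) (F : Finset (Finset (Sym2 V))), IsFracMatching G x ∧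
      (∀ y, IsFracMatching G y → φ y ≤ φ x) ∧ IsHalfIntegral x ∧ IsCycleFamily G x F ∧
      ∀ u, load x u = 0 ∨ load x u = 1 := by
  obtain ⟨x, hx, ho⟩ := exists_optimal G φ
  obtain ⟨S, k, hS, hsat⟩ := hx.exists_packing
  obtain ⟨z, F, hz, hh, hF, -, hl, hφ⟩ :=
    hS.exists_optimal hx hx ho ho le_sup_left fun u hu _ => hsat u hu
  refine ⟨z, F, hz.mono hx.posGraph_le, fun y hy => hφ ▸ ho y hy, hh, hF.mono hx.posGraph_le,
    fun u => ?_⟩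
  rw [hl]
  split_ifs <;> simp

theorem exists_card_eq_gamma (G : SimpleGraph V) (w : Sym2 V → ℝ) :
    ∃ (x : Sym2 V → ℝ) (F : Finset (Finset (Sym2 V))),
      IsMaxFracMatching G w x ∧ IsHalfIntegral x ∧ IsCycleFamily G x F ∧ F.card = gamma G w := by
  refine Nat.sInf_mem (s := {n : ℕ | ∃ (x : Sym2 V → ℝ) (F : Finset (Finset (Sym2 V))),
    IsMaxFracMatching G w x ∧ IsHalfIntegral x ∧ IsCycleFamily G x F ∧ F.card = n}) ?_
  rcases isEmpty_or_nonempty V with hV | ⟨⟨v⟩⟩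
  · refine ⟨0, 0, ∅, ⟨⟨by simp, by simp, by simp⟩, fun y _ => ?_⟩, by simp [IsHalfIntegral],
      ⟨by simp, by simp, by simp⟩, by simp⟩
    simp [fracWeight]
  · obtain ⟨x, F, hx, ho, hh, hF, -⟩ := exists_basic_optimal G (penalised w 0 v)
    exact ⟨F.card, x, F, ⟨hx, by simpa [penalised_apply] using ho⟩, hh, hF, rfl⟩

theorem gamma_le {w x : Sym2 V → ℝ} {F : Finset (Finset (Sym2 V))} (hx : IsMaxFracMatching G w x)
    (hh : IsHalfIntegral x) (hF : IsCycleFamily G x F) : gamma G w ≤ F.card :=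
  Nat.sInf_le ⟨x, F, hx, hh, hF, rfl⟩

/-- A basic fractional matching contains a matching of its support exposing at most one saturated
vertex per odd cycle. -/
theorem IsCycleFamily.exists_involution {x : Sym2 V → ℝ} {F : Finset (Finset (Sym2 V))}
    (hF : IsCycleFamily G x F) (hx : IsFracMatching G x) (hh : IsHalfIntegral x) :
    ∃ M : Equiv.Perm V, (∀ u, M (M u) = u) ∧ (∀ u, M u ≠ u → (posGraph x).Adj u (M u)) ∧
      ∃ E : Finset V, E.card ≤ F.card ∧ ∀ u, load x u = 1 → M u = u → u ∈ E := by
  obtain ⟨S, hS, hsat⟩ := hF.exists_packing hx hh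
  obtain ⟨T, -, hT, hcard⟩ := hS.exists_matching
  obtain ⟨M, 𝒞, h1, h2, -, -, -, h𝒞, h3⟩ := hT.exists_perm
  rw [Finset.card_eq_zero] at h𝒞
  subst h𝒞
  refine ⟨M, h1, h2, S \ T, hcard, fun u hu hMu => ?_⟩
  simp [h3, hMu, hsat u hu]

theorem isFracMatching_deleteVerts_singleton {x : Sym2 V → ℝ} {v : V} :
    IsFracMatching (deleteVerts G {v}) x ↔ IsFracMatching G x ∧ load x v = 0 := by
  refine ⟨fun h => ⟨h.mono fun _ _ => And.left, Finset.sum_eq_zero fun u _ => h.2.1 _ fun h' => ?_⟩,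
    fun ⟨h, hl⟩ => ⟨h.1, fun e he => ?_, h.2.2⟩⟩
  · exact h'.2.1 rfl
  · by_cases hv : v ∈ e
    · exact le_antisymm (hl ▸ h.le_load hv) (h.1 e)
    · refine h.2.1 e fun h' => he ?_
      induction e with
      | _ a b =>
        rw [Sym2.mem_iff, not_or] at hv
        exact ⟨h', fun h => hv.1 h.symm, fun h => hv.2 h.symm⟩

/-- Penalising the load of `v` by the loss in weight caused by deleting `v` makes the optima before
and after the deletion simultaneously optimal. -/
theorem penalised_optimal {w x₁ x₂ : Sym2 V → ℝ} {v : V} (h₁ : IsMaxFracMatching G w x₁)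
    (h₂ : IsMaxFracMatching (deleteVerts G {v}) w x₂) :
    ∃ t, (∀ y, IsFracMatching G y → penalised w t v y ≤ penalised w t v x₁) ∧
      (∀ y, IsFracMatching G y → penalised w t v y ≤ penalised w t v x₂) ∧
      fracWeight w x₁ = fracWeight w x₂ + t ∧ (t = 0 ∨ load x₁ v = 1) := by
  obtain ⟨h₂G, hl₂⟩ := isFracMatching_deleteVerts_singleton.1 h₂.1
  set t := fracWeight w x₁ - fracWeight w x₂ with ht
  have ht0 : 0 ≤ t := sub_nonneg.2 (h₁.2 _ h₂G)
  have hle : ∀ y, IsFracMatching G y → penalised w t v y ≤ fracWeight w x₂ := by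
    obtain ⟨z, -, hz, ho, -, -, hl⟩ := exists_basic_optimal G (penalised w t v)
    refine fun y hy => (ho y hy).trans ?_
    rw [penalised_apply]
    rcases hl v with h | h
    · rw [h, mul_zero, sub_zero]
      exact h₂.2 z (isFracMatching_deleteVerts_singleton.2 ⟨hz, h⟩)
    · rw [h, mul_one]
      linarith [h₁.2 z hz]
  have e₂ : penalised w t v x₂ = fracWeight w x₂ := by rw [penalised_apply, hl₂]; ring
  have hl₁ : load x₁ v ≤ 1 := h₁.1.2.2 v
  have hmul : 0 ≤ t * (1 - load x₁ v) := mul_nonneg ht0 (sub_nonneg.2 hl₁)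
  have hle₁ := hle x₁ h₁.1
  have e₁ : penalised w t v x₁ = fracWeight w x₂ := by
    refine le_antisymm hle₁ ?_
    rw [penalised_apply]
    linarith
  refine ⟨t, fun y hy => e₁ ▸ hle y hy, fun y hy => e₂ ▸ hle y hy, by ring, ?_⟩
  rw [penalised_apply] at e₁
  have : t * (1 - load x₁ v) = 0 := by linarith
  rcases mul_eq_zero.1 this with h | h
  · exact .inl h
  · exact .inr (by linarith)

theorem gamma_le_gamma_deleteVerts_add_one (G : SimpleGraph V) (w : Sym2 V → ℝ) (v : V) :
    gamma G w ≤ gamma (deleteVerts G {v}) w + 1 := by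
  classical
  obtain ⟨x₁, F₁, h₁, -, -, -⟩ := exists_card_eq_gamma G w
  obtain ⟨x₂, F₂, h₂, hh₂, hF₂, hk⟩ := exists_card_eq_gamma (deleteVerts G {v}) w
  obtain ⟨t, o₁, o₂, hw, ht⟩ := penalised_optimal h₁ h₂
  obtain ⟨h₂G, hl₂⟩ := isFracMatching_deleteVerts_singleton.1 h₂.1
  have hF₂G : IsCycleFamily G x₂ F₂ := hF₂.mono fun _ _ => And.left
  rcases ht with rfl | ht
  · have := gamma_le (w := w) ⟨h₂G, fun y hy => by linarith [h₁.2 y hy]⟩ hh₂ hF₂G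
    lia
  obtain ⟨M, hM, hMadj, E, hE, hEmem⟩ := hF₂G.exists_involution h₂G hh₂
  obtain ⟨S, k, hS, hsat⟩ := h₁.1.exists_packing
  obtain ⟨S', k', hYS', hS', hk'⟩ := exists_packing_le (K := posGraph x₁ ⊔ posGraph x₂)
    (Y := insert v (Finset.univ.filter fun u => load x₁ u = 1 ∧ load x₂ u = 1))
    (r := gamma (deleteVerts G {v}) w + 1) (fun u hu => by
      simp only [Finset.mem_insert, Finset.mem_filter, Finset.mem_univ, true_and] at hu
      rcases hu with rfl | hu
      · exact hsat _ ht
      · exact hsat _ hu.1) (hS.mono le_sup_left) M hM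
    (fun u hu => Or.inr (hMadj u hu)) (by
      refine (Finset.card_le_card (t := insert v E) fun u hu => ?_).trans
        ((Finset.card_insert_le _ _).trans (by lia))
      simp only [Finset.mem_insert, Finset.mem_filter, Finset.mem_univ, true_and] at hu ⊢
      exact hu.1.imp_right fun h => hEmem u h.2 hu.2)
  obtain ⟨z, F, hz, hh, hF, hcard, hl, hφ⟩ := hS'.exists_optimal h₁.1 h₂G o₁ o₂ le_rfl
    (fun u hu hu' => hYS' (by simp [hu, hu']))
  have hle : posGraph x₁ ⊔ posGraph x₂ ≤ G := sup_le h₁.1.posGraph_le h₂G.posGraph_le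
  rw [penalised_apply, penalised_apply, hl, if_pos (hYS' (by simp)), ht] at hφ
  have := gamma_le (w := w) ⟨hz.mono hle, fun y hy => by linarith [h₁.2 y hy]⟩ hh (hF.mono hle)
  lia

theorem gamma_deleteVerts_le_gamma_add_one (G : SimpleGraph V) (w : Sym2 V → ℝ) (v : V) :
    gamma (deleteVerts G {v}) w ≤ gamma G w + 1 := by
  classical
  obtain ⟨x₁, F₁, h₁, hh₁, hF₁, hk⟩ := exists_card_eq_gamma G w
  obtain ⟨x₂, F₂, h₂, -, -, -⟩ := exists_card_eq_gamma (deleteVerts G {v}) w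
  obtain ⟨t, o₁, o₂, hw, -⟩ := penalised_optimal h₁ h₂
  obtain ⟨h₂G, hl₂⟩ := isFracMatching_deleteVerts_singleton.1 h₂.1
  obtain ⟨M, hM, hMadj, E, hE, hEmem⟩ := hF₁.exists_involution h₁.1 hh₁
  have hj := M.injective
  have vv : (M * Equiv.swap v (M v)) v = v := by simp [hM]
  have vm : (M * Equiv.swap v (M v)) (M v) = M v := by simp
  have vo : ∀ u, u ≠ v → u ≠ M v → (M * Equiv.swap v (M v)) u = M u := fun u h h' => by
    simp [Equiv.swap_apply_of_ne_of_ne h h']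
  generalize M * Equiv.swap v (M v) = N at vv vm vo
  have hN : ∀ u, N (N u) = u := fun u => by
    by_cases hv : u = v
    · rw [hv, vv, vv]
    · by_cases hm : u = M v
      · rw [hm, vm, vm]
      · rw [vo u hv hm, vo (M u) (fun h => hm (by rw [← h, hM])) (fun h => hv (hj h)), hM]
  obtain ⟨S, k, hS, hsat⟩ := h₂.1.exists_packing
  obtain ⟨S', k', hYS', hS', hk'⟩ := exists_packing_le
    (K := (posGraph x₁ ⊔ posGraph x₂) ⊓ deleteVerts G {v})
    (Y := Finset.univ.filter fun u => load x₁ u = 1 ∧ load x₂ u = 1)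
    (r := gamma G w + 1) (fun u hu => by
      simp only [Finset.mem_filter, Finset.mem_univ, true_and] at hu
      exact hsat _ hu.2) (hS.mono (le_inf le_sup_right h₂.1.posGraph_le)) N hN
    (fun u hu => by
      have hv : u ≠ v := fun h => hu (by rw [h, vv])
      have hm : u ≠ M v := fun h => hu (by rw [h, vm])
      rw [vo u hv hm] at hu ⊢
      have hadj := hMadj u hu
      exact ⟨Or.inl hadj, h₁.1.posGraph_le hadj, hv, fun h => hm (by rw [← h, hM])⟩) (by
      refine (Finset.card_le_card (t := insert (M v) E) fun u hu => ?_).trans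
        ((Finset.card_insert_le _ _).trans (by lia))
      simp only [Finset.mem_insert, Finset.mem_filter, Finset.mem_univ, true_and] at hu ⊢
      by_cases hm : u = M v
      · exact .inl hm
      · have hv : u ≠ v := fun h => by
          have := hu.1.2
          rw [h, hl₂] at this
          exact zero_ne_one this
        exact .inr (hEmem u hu.1.1 (by rw [← vo u hv hm, hu.2])))
  obtain ⟨z, F, hz, hh, hF, hcard, hl, hφ⟩ := hS'.exists_optimal h₁.1 h₂G o₁ o₂ inf_le_left
    (fun u hu hu' => hYS' (by simp [hu, hu']))
  have hzH := hz.mono (L := deleteVerts G {v}) inf_le_right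
  have hlz := (isFracMatching_deleteVerts_singleton.1 hzH).2
  have hφ₂ : penalised w t v x₁ = penalised w t v x₂ := le_antisymm (o₂ _ h₁.1) (o₁ _ h₂G)
  rw [hφ₂, penalised_apply, penalised_apply, hlz, hl₂] at hφ
  have := gamma_le (w := w) ⟨hzH, fun y hy => by linarith [h₂.2 y hy]⟩ hh (hF.mono inf_le_right)
  lia

/-- deleting an edge decreases γ by at most two: γ(G∖e) ≥ γ(G) − 2. -/
theorem gamma_deleteEdge
    {V : Type*} [Fintype V] [DecidableEq V]
    (G : SimpleGraph V) (w : Sym2 V → ℝ) (hw : ∀ e, 0 ≤ w e)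
    (e : Sym2 V) (he : e ∈ G.edgeSet) :
    gamma G w - 2 ≤ gamma (G.deleteEdges {e}) w := by
  induction e with
  | _ a b =>
    have heq : deleteVerts (G.deleteEdges {s(a, b)}) {b} = deleteVerts G {b} := by
      ext p q
      simp only [deleteVerts, SimpleGraph.deleteEdges_adj, Set.mem_singleton_iff, Sym2.eq_iff]
      tauto
    have h1 := gamma_le_gamma_deleteVerts_add_one G w b
    have h2 := gamma_deleteVerts_le_gamma_add_one (G.deleteEdges {s(a, b)}) w b
    rw [heq] at h2
    lia

end Stabilizer
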